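/- arXiv:2101.00834 — 7 statements merged into one kernel-verified Lean document; each statement's English description precedes it below -/
import Mathlib

section
/- Let 𝔖 = (S, 𝒰, T) be a CMP, 𝒫 = (B_1, …, B_ℓ) a parity partition of S, ρ a stationary policy, and W := WinDom(𝔖, ρ). Then for every s ∈ S: if s ∈ W then P_s^ρ(𝔖 ⊨ Parity(𝒫)) = 1, and if s ∉ W then P_s^ρ(𝔖 ⊨ Parity(𝒫)) ≥ P_s^ρ(𝔖 ⊨ ◇W). -/
open MeasureTheory

/-- Let `𝔖 = (S, 𝒰, T)` be a CMP, `𝒫 = (B_1, …, B_ℓ)` a parity partition of `S`,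
`ρ` a stationary policy, and `W := WinDom(𝔖, ρ)`. Then for every `s ∈ S`: if `s ∈ W` then
`P_s^ρ(𝔖 ⊨ Parity(𝒫)) = 1`, and if `s ∉ W` then
`P_s^ρ(𝔖 ⊨ Parity(𝒫)) ≥ P_s^ρ(𝔖 ⊨ ◇W)`. -/
theorem stmt0
    -- the state space: a standard Borel space
    {S : Type*} [MeasurableSpace S] [StandardBorelSpace S]
    -- the input space: a finite nonempty set
    {U : Type*} [Finite U] [Nonempty U]
    -- the transition probability kernel
    (T : S → U → Measure S)
    (hT : ∀ s u, IsProbabilityMeasure (T s u))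
    (hTmeas : ∀ (u : U) (A : Set S), MeasurableSet A → Measurable fun s => T s u A)
    -- a stationary (measurable) policy
    (ρ : S → U) (hρ : ∀ u : U, MeasurableSet {s | ρ s = u})
    -- the induced family of path measures `P_s^ρ` on `S^ℕ` (Ionescu–Tulcea):
    -- characterized as the unique Markov family with initial state `s` and
    -- transitions `T(·|·, ρ(·))`
    (P : S → Measure (ℕ → S))
    (hPprob : ∀ s, IsProbabilityMeasure (P s))
    (hPmeas : ∀ B : Set (ℕ → S), MeasurableSet B → Measurable fun s => P s B)
    (hP0 : ∀ s, P s {w | w 0 = s} = 1)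
    (hPMarkov : ∀ (s : S) (B : Set (ℕ → S)), MeasurableSet B →
      P s ((fun (w : ℕ → S) (n : ℕ) => w (n + 1)) ⁻¹' B) = ∫⁻ t, P t B ∂(T s (ρ s)))
    -- the parity partition `𝒫 = (B_1, …, B_ℓ)`
    (ℓ : ℕ) (B : ℕ → Set S)
    (hBmeas : ∀ i ∈ Finset.Icc 1 ℓ, MeasurableSet (B i))
    (hBdisj : ∀ i ∈ Finset.Icc 1 ℓ, ∀ j ∈ Finset.Icc 1 ℓ, i ≠ j → Disjoint (B i) (B j))
    (hBcover : ⋃ i ∈ Finset.Icc 1 ℓ, B i = Set.univ)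
    -- the parity event `𝔖 ⊨ Parity(𝒫)`
    (Par : Set (ℕ → S))
    (hPar : Par = {w | ∀ i ∈ Finset.Icc 1 ℓ, Odd i → {k | w k ∈ B i}.Infinite →
      ∃ j ∈ Finset.Icc (i + 1) ℓ, Even j ∧ {k | w k ∈ B j}.Infinite})
    -- the almost-sure winning region `W = WinDom(𝔖, ρ)`
    (W : Set S) (hW : W = {s | P s Par = 1}) :
    ∀ s : S,
      (s ∈ W → P s Par = 1) ∧
      (s ∉ W → P s {w | ∃ n : ℕ, w n ∈ W} ≤ P s Par) := by
  have hInfMeas : ∀ i ∈ Finset.Icc 1 ℓ,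
      MeasurableSet {w : ℕ → S | {k | w k ∈ B i}.Infinite} := by
    intro i hi
    have : {w : ℕ → S | {k | w k ∈ B i}.Infinite} =
        ⋂ a : ℕ, ⋃ b : ℕ, ⋃ _ : b ≥ a, (fun w : ℕ → S => w b) ⁻¹' (B i) := by
      ext w
      simp only [Set.mem_ofPred_eq, Set.mem_iInter, Set.mem_iUnion, Set.mem_preimage]
      rw [← Nat.frequently_atTop_iff_infinite, Filter.frequently_atTop]
      simp only [exists_prop]
    rw [this]
    exact MeasurableSet.iInter fun a => MeasurableSet.iUnion fun b =>
      MeasurableSet.iUnion fun _ => (measurable_pi_apply b) (hBmeas i hi)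
  have hParMeas : MeasurableSet Par := by
    have : Par = ⋂ i ∈ Finset.Icc 1 ℓ, ⋂ _ : Odd i,
        ({w : ℕ → S | {k | w k ∈ B i}.Infinite}ᶜ ∪
          ⋃ j ∈ Finset.Icc (i + 1) ℓ, ⋃ _ : Even j,
            {w : ℕ → S | {k | w k ∈ B j}.Infinite}) := by
      rw [hPar]
      ext w
      simp only [Set.mem_ofPred_eq, Set.mem_iInter, Set.mem_iUnion, Set.mem_union,
        Set.mem_compl_iff, exists_prop, imp_iff_not_or]
    rw [this]
    refine Finset.measurableSet_biInter _ fun i hi => MeasurableSet.iInter fun _ => ?_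
    refine (hInfMeas i hi).compl.union ?_
    refine Finset.measurableSet_biUnion _ fun j hj => MeasurableSet.iUnion fun _ => ?_
    refine hInfMeas j ?_
    rw [Finset.mem_Icc] at hj ⊢
    omega
  have hInfShift : ∀ (w : ℕ → S) (A : Set S),
      {k | w (k + 1) ∈ A}.Infinite ↔ {k | w k ∈ A}.Infinite := by
    intro w A
    rw [← Nat.frequently_atTop_iff_infinite, ← Nat.frequently_atTop_iff_infinite]
    rw [Filter.frequently_atTop, Filter.frequently_atTop]
    constructor
    · intro h a
      obtain ⟨b, hb, hw⟩ := h a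
      exact ⟨b + 1, by omega, hw⟩
    · intro h a
      obtain ⟨b, hb, hw⟩ := h (a + 1)
      obtain ⟨c, rfl⟩ : ∃ c, b = c + 1 := ⟨b - 1, by omega⟩
      exact ⟨c, by omega, hw⟩
  have hShift : ∀ w : ℕ → S, (fun n => w (n + 1)) ∈ Par ↔ w ∈ Par := by
    intro w
    rw [hPar]
    simp only [Set.mem_ofPred_eq, hInfShift]
  have hWMeas : MeasurableSet W := by
    rw [hW]
    exact hPmeas Par hParMeas (measurableSet_singleton 1)
  have key : ∀ (n : ℕ) (s : S), P s {w | w n ∈ W ∧ w ∉ Par} = 0 := by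
    intro n
    induction n with
    | zero =>
      intro s
      have := hPprob s
      by_cases hs : s ∈ W
      · have h1 : P s Par = 1 := by rw [hW] at hs; exact hs
        have h2 : P s Parᶜ = 0 := (prob_compl_eq_zero_iff hParMeas).2 h1
        exact measure_mono_null (fun w hw => hw.2) h2
      · have hm : MeasurableSet {w : ℕ → S | w 0 = s} :=
          measurableSet_eq_fun (measurable_pi_apply 0) measurable_const
        have h2 := (prob_compl_eq_zero_iff hm).2 (hP0 s)
        refine measure_mono_null (fun w hw => ?_) h2
        intro h0
        have h0' : w 0 = s := h0
        exact hs (h0' ▸ hw.1)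
    | succ n ih =>
      intro s
      have hm : MeasurableSet {w : ℕ → S | w n ∈ W ∧ w ∉ Par} :=
        ((measurable_pi_apply n) hWMeas).inter hParMeas.compl
      have he : {w : ℕ → S | w (n + 1) ∈ W ∧ w ∉ Par} =
          (fun (w : ℕ → S) (n : ℕ) => w (n + 1)) ⁻¹' {w | w n ∈ W ∧ w ∉ Par} := by
        ext w
        simp only [Set.mem_ofPred_eq, Set.mem_preimage, hShift]
      rw [he, hPMarkov s _ hm]
      simp [ih]
  intro s
  refine ⟨fun hs => by rw [hW] at hs; exact hs, fun _ => ?_⟩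
  have hU : P s (⋃ n : ℕ, {w | w n ∈ W ∧ w ∉ Par}) = 0 :=
    measure_iUnion_null fun n => key n s
  calc P s {w | ∃ n : ℕ, w n ∈ W}
      ≤ P s (Par ∪ ⋃ n : ℕ, {w | w n ∈ W ∧ w ∉ Par}) := by
        refine measure_mono ?_
        rintro w ⟨n, hn⟩
        by_cases hw : w ∈ Par
        · exact Or.inl hw
        · exact Or.inr (Set.mem_iUnion.2 ⟨n, hn, hw⟩)
    _ ≤ P s Par + P s (⋃ n : ℕ, {w | w n ∈ W ∧ w ∉ Par}) := measure_union_le _ _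
    _ = P s Par := by rw [hU, add_zero]
end

section
/- Let 𝔖 = (S, 𝒰, T) be a CMP, 𝒫 = (B_1, …, B_ℓ) a parity partition of S, ρ a stationary policy, and W := WinDom(𝔖, ρ). Then W is an absorbing set for the closed-loop kernel: T(W | s, ρ(s)) = 1 for every s ∈ W. -/
open MeasureTheory

/-- Let `𝔖 = (S, 𝒰, T)` be a CMP, `𝒫 = (B_1, …, B_ℓ)` a parity partition of `S`,
`ρ` a stationary policy, and `W := WinDom(𝔖, ρ)`. Then `W` is an absorbing set for the
closed-loop kernel: `T(W | s, ρ(s)) = 1` for every `s ∈ W`. -/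
theorem stmt1
    {S : Type*} [MeasurableSpace S] [StandardBorelSpace S]
    {U : Type*} [Finite U] [Nonempty U]
    (T : S → U → Measure S)
    (hT : ∀ s u, IsProbabilityMeasure (T s u))
    (hTmeas : ∀ (u : U) (A : Set S), MeasurableSet A → Measurable fun s => T s u A)
    (ρ : S → U) (hρ : ∀ u : U, MeasurableSet {s | ρ s = u})
    -- the induced family of path measures `P_s^ρ` (Ionescu–Tulcea)
    (P : S → Measure (ℕ → S))
    (hPprob : ∀ s, IsProbabilityMeasure (P s))
    (hPmeas : ∀ B : Set (ℕ → S), MeasurableSet B → Measurable fun s => P s B)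
    (hP0 : ∀ s, P s {w | w 0 = s} = 1)
    (hPMarkov : ∀ (s : S) (B : Set (ℕ → S)), MeasurableSet B →
      P s ((fun (w : ℕ → S) (n : ℕ) => w (n + 1)) ⁻¹' B) = ∫⁻ t, P t B ∂(T s (ρ s)))
    -- the parity partition `𝒫 = (B_1, …, B_ℓ)`
    (ℓ : ℕ) (B : ℕ → Set S)
    (hBmeas : ∀ i ∈ Finset.Icc 1 ℓ, MeasurableSet (B i))
    (hBdisj : ∀ i ∈ Finset.Icc 1 ℓ, ∀ j ∈ Finset.Icc 1 ℓ, i ≠ j → Disjoint (B i) (B j))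
    (hBcover : ⋃ i ∈ Finset.Icc 1 ℓ, B i = Set.univ)
    -- the parity event `𝔖 ⊨ Parity(𝒫)`
    (Par : Set (ℕ → S))
    (hPar : Par = {w | ∀ i ∈ Finset.Icc 1 ℓ, Odd i → {k | w k ∈ B i}.Infinite →
      ∃ j ∈ Finset.Icc (i + 1) ℓ, Even j ∧ {k | w k ∈ B j}.Infinite})
    -- the almost-sure winning region `W = WinDom(𝔖, ρ)`
    (W : Set S) (hW : W = {s | P s Par = 1}) :
    ∀ s ∈ W, T s (ρ s) W = 1 := by
  have hinf : ∀ (A : Set S) (w : ℕ → S),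
      {k | w k ∈ A}.Infinite ↔ ∀ n, ∃ k, n ≤ k ∧ w k ∈ A := by
    intro A w
    rw [← Nat.frequently_atTop_iff_infinite, Filter.frequently_atTop]
  have hinfMeas : ∀ A : Set S, MeasurableSet A →
      MeasurableSet {w : ℕ → S | {k | w k ∈ A}.Infinite} := by
    intro A hA
    simp only [hinf]
    simp only [Set.setOf_forall, Set.setOf_exists]
    refine MeasurableSet.iInter fun n => MeasurableSet.iUnion fun k => ?_
    exact (MeasurableSet.const _).inter (measurable_pi_apply k hA)
  have hshift : ∀ (A : Set S) (w : ℕ → S),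
      {k | w (k + 1) ∈ A}.Infinite ↔ {k | w k ∈ A}.Infinite := by
    intro A w
    rw [hinf A w, hinf A (fun k => w (k + 1))]
    constructor
    · intro h n
      obtain ⟨k, hk, hw⟩ := h n
      exact ⟨k + 1, by omega, hw⟩
    · intro h n
      obtain ⟨k, hk, hw⟩ := h (n + 1)
      refine ⟨k - 1, by omega, ?_⟩
      have : k - 1 + 1 = k := by omega
      simpa only [this] using hw
  have hParMeas : MeasurableSet Par := by
    have heq : Par = ⋂ i ∈ Finset.Icc 1 ℓ, ⋂ (_ : Odd i),
        ({w : ℕ → S | {k | w k ∈ B i}.Infinite}ᶜ ∪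
          ⋃ j ∈ Finset.Icc (i + 1) ℓ, ⋃ (_ : Even j),
            {w : ℕ → S | {k | w k ∈ B j}.Infinite}) := by
      rw [hPar]
      ext w
      simp only [Set.mem_setOf_eq, Set.mem_iInter, Set.mem_union, Set.mem_compl_iff,
        Set.mem_iUnion, exists_prop, imp_iff_not_or]
    rw [heq]
    refine Finset.measurableSet_biInter _ fun i hi => MeasurableSet.iInter fun _ => ?_
    refine (hinfMeas _ (hBmeas i hi)).compl.union ?_
    refine Finset.measurableSet_biUnion _ fun j hj => MeasurableSet.iUnion fun _ => ?_
    refine hinfMeas _ (hBmeas j ?_)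
    rw [Finset.mem_Icc] at hj ⊢
    omega
  have hParShift : (fun (w : ℕ → S) (n : ℕ) => w (n + 1)) ⁻¹' Parᶜ = Parᶜ := by
    rw [hPar]
    ext w
    simp only [Set.mem_preimage, Set.mem_compl_iff, Set.mem_setOf_eq, hshift]
  intro s hs
  rw [hW, Set.mem_setOf_eq] at hs
  have := hT s (ρ s)
  have h0 : P s Parᶜ = 0 := (prob_compl_eq_zero_iff hParMeas).2 hs
  rw [← hParShift, hPMarkov s _ hParMeas.compl,
    lintegral_eq_zero_iff (hPmeas _ hParMeas.compl)] at h0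
  have hWm : MeasurableSet W := by
    rw [hW]
    exact hPmeas _ hParMeas (measurableSet_singleton 1)
  rw [← mem_ae_iff_prob_eq_one hWm]
  filter_upwards [h0] with t ht
  rw [hW]
  exact (prob_compl_eq_zero_iff hParMeas).1 ht
end

section
/- Let G = (V, E, (V_0, V_1, V_r)) be a 2½-player game graph and B, T ⊆ V, with B^c := V∖B. Let Y* be the value of the nested fixpoint νY. μX. (B^c ∩ Apre(Y, X)) ∪ (B ∩ Cpre(Y)) ∪ T, i.e., the greatest fixed point over Y of the map sending Y to the least fixed point over X of X ↦ (B^c ∩ Apre(Y, X)) ∪ (B ∩ Cpre(Y)) ∪ T. Then for every v ∈ Y* there exists a deterministic memoryless Player-0 strategy π_0 ∈ Π_0^DM such that for every π_1 ∈ Π_1, P_v^{π_0,π_1}((□◇B) ∪ (◇T)) = 1. -/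
open MeasureTheory
open scoped ENNReal

/-- A 2½-player game graph: a finite set of vertices `V`, an edge relation `E`, and a
partition of `V` into Player-0 vertices `V0`, Player-1 vertices `V1` and random vertices
`Vr` (the partition and nonemptiness conditions are stated via `IsGameGraph`). -/
structure GameGraph (V : Type*) where
  E : V → Set V
  V0 : Set V
  V1 : Set V
  Vr : Set V

/-- The defining conditions of a 2½-player game graph: every vertex has a successor and
`(V0, V1, Vr)` is a partition of `V`. -/
def GameGraph.IsGameGraph {V : Type*} (G : GameGraph V) : Prop :=
  (∀ v, (G.E v).Nonempty) ∧ G.V0 ∪ G.V1 ∪ G.Vr = Set.univ ∧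
    Disjoint G.V0 G.V1 ∧ Disjoint G.V0 G.Vr ∧ Disjoint G.V1 G.Vr

/-- A (randomized, history-dependent) strategy: it assigns to every history `h ∈ V*` and
current vertex `v` a probability distribution supported on the successors `E(v)`. -/
def IsStrategy {V : Type*} (G : GameGraph V) (σ : List V → V → PMF V) : Prop :=
  ∀ (h : List V) (v : V), (σ h v).support ⊆ G.E v

/-- Deterministic memoryless strategies. -/
def IsDM {V : Type*} (σ : List V → V → PMF V) : Prop :=
  ∃ f : V → V, ∀ (h : List V) (v : V), σ h v = PMF.pure (f v)

open scoped Classical in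
/-- One-step transition probability: at a Player-0 vertex `π0` moves, at a Player-1 vertex
`π1` moves, and at a random vertex the successor is drawn uniformly at random from `E(v)`. -/
noncomputable def stepProb {V : Type*} (G : GameGraph V)
    (π0 π1 : List V → V → PMF V) (h : List V) (v x : V) : ℝ≥0∞ :=
  if v ∈ G.V0 then π0 h v x
  else if v ∈ G.V1 then π1 h v x
  else if x ∈ G.E v then ((G.E v).ncard : ℝ≥0∞)⁻¹ else 0

/-- Probability that, starting at vertex `v` with past history `h`, the run continues with
the finite sequence of vertices `l`. -/
noncomputable def extProb {V : Type*} (G : GameGraph V)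
    (π0 π1 : List V → V → PMF V) : List V → V → List V → ℝ≥0∞
  | _, _, [] => 1
  | h, v, x :: rest => stepProb G π0 π1 h v x * extProb G π0 π1 (h ++ [v]) x rest

open scoped Classical in
/-- Probability that the run started at `v` begins with the finite sequence `l`. -/
noncomputable def prefixProb {V : Type*} (G : GameGraph V)
    (π0 π1 : List V → V → PMF V) (v : V) : List V → ℝ≥0∞
  | [] => 1
  | x :: rest => if x = v then extProb G π0 π1 [] v rest else 0

/-- The cylinder set of runs beginning with the finite word `l`. -/
def cyl {V : Type*} (l : List V) : Set (ℕ → V) :=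
  {r | ∀ i : Fin l.length, r i = l.get i}

/-- `P` is the probability measure `P_v^{π0,π1}` on the run space `V^ℕ` (obtained by the
Ionescu–Tulcea construction): it is a probability measure whose cylinder probabilities are
the finite-run probabilities determined by `π0`, `π1` and the uniform choices at random
vertices. -/
def IsRunMeasure {V : Type*} [MeasurableSpace V] (G : GameGraph V)
    (π0 π1 : List V → V → PMF V) (v : V) (P : Measure (ℕ → V)) : Prop :=
  IsProbabilityMeasure P ∧ ∀ l : List V, P (cyl l) = prefixProb G π0 π1 v l

/-- Controllable predecessor. -/
def Cpre {V : Type*} (G : GameGraph V) (C : Set V) : Set V :=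
  {v ∈ G.V0 | (G.E v ∩ C).Nonempty} ∪ {v ∈ G.V1 ∪ G.Vr | G.E v ⊆ C}

/-- Almost-sure predecessor. -/
def Apre {V : Type*} (G : GameGraph V) (C D : Set V) : Set V :=
  Cpre G D ∪ {v ∈ G.Vr | G.E v ⊆ C ∧ (G.E v ∩ D).Nonempty}

/-- Least fixed point (Knaster–Tarski) of an operator on sets of vertices. -/
def lfpSet {V : Type*} (f : Set V → Set V) : Set V := sInf {A | f A ⊆ A}

/-- Greatest fixed point (Knaster–Tarski) of an operator on sets of vertices. -/
def gfpSet {V : Type*} (f : Set V → Set V) : Set V := sSup {A | A ⊆ f A}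


section Aux

variable {V : Type*}

theorem Cpre_mono (G : GameGraph V) {C D : Set V} (h : C ⊆ D) : Cpre G C ⊆ Cpre G D := by
  rintro v (⟨h0, h1⟩ | ⟨h0, h1⟩)
  · exact Or.inl ⟨h0, h1.mono (Set.inter_subset_inter_right _ h)⟩
  · exact Or.inr ⟨h0, h1.trans h⟩

theorem Apre_mono (G : GameGraph V) {C D C' D' : Set V} (h : C ⊆ C') (hD : D ⊆ D') :
    Apre G C D ⊆ Apre G C' D' := by
  rintro v (h0 | ⟨h0, h1, h2⟩)
  · exact Or.inl (Cpre_mono G hD h0)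
  · exact Or.inr ⟨h0, h1.trans h, h2.mono (Set.inter_subset_inter_right _ hD)⟩

/-- The one-step operator. -/
def opF (G : GameGraph V) (B T Y X : Set V) : Set V :=
  (Bᶜ ∩ Apre G Y X) ∪ (B ∩ Cpre G Y) ∪ T

theorem opF_mono (G : GameGraph V) (B T : Set V) {Y Y' X X' : Set V} (h : Y ⊆ Y') (hD : X ⊆ X') :
    opF G B T Y X ⊆ opF G B T Y' X' :=
  Set.union_subset_union_left _ (Set.union_subset_union
    (Set.inter_subset_inter_right _ (Apre_mono G h hD))
    (Set.inter_subset_inter_right _ (Cpre_mono G h)))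

theorem gfp_sub (G : GameGraph V) (B T : Set V) (Y : Set V)
    (hY : Y = gfpSet (fun Y => lfpSet (fun X => opF G B T Y X))) :
    Y ⊆ lfpSet (fun X => opF G B T Y X) := by
  intro v hv
  have hv' := hv
  rw [hY] at hv'
  obtain ⟨A, hA, hvA⟩ := hv'
  have hAY : A ⊆ Y := by
    rw [hY]; intro x hx; exact ⟨A, hA, hx⟩
  have := hA hvA
  intro Z hZ
  exact this Z ((opF_mono G B T hAY (le_refl Z)).trans hZ)

theorem lfp_sub_gfp (G : GameGraph V) (B T : Set V) (Y : Set V)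
    (hY : Y = gfpSet (fun Y => lfpSet (fun X => opF G B T Y X))) :
    lfpSet (fun X => opF G B T Y X) ⊆ Y := by
  have h1 := gfp_sub G B T Y hY
  intro x hx
  rw [hY]
  refine ⟨lfpSet (fun X => opF G B T Y X), ?_, hx⟩
  intro y hy Z hZ
  exact hy Z ((opF_mono G B T h1 (le_refl Z)).trans hZ)

/-- Rank function. -/
theorem exists_rank [Finite V] (G : GameGraph V) (B T : Set V) (Y : Set V)
    (hY : Y ⊆ lfpSet (fun X => opF G B T Y X))
    (hY2 : lfpSet (fun X => opF G B T Y X) ⊆ Y) :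
    ∃ (rk : V → ℕ) (N : ℕ), (∀ v ∈ Y, 1 ≤ rk v ∧ rk v ≤ N) ∧
      ∀ v ∈ Y, v ∈ opF G B T Y {x | x ∈ Y ∧ rk x < rk v} := by
  classical
  set F := opF G B T Y with hF
  have hFm : Monotone F := fun a b h => opF_mono G B T (le_refl Y) h
  have hXm : Monotone (fun n => F^[n] (∅ : Set V)) :=
    hFm.monotone_iterate_of_le_map (Set.empty_subset _)
  obtain ⟨N, hN⟩ := WellFoundedGT.monotone_chain_condition
    (⟨fun n => F^[n] (∅ : Set V), hXm⟩ : ℕ →o Set V)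
  have hN1 : F^[N] (∅ : Set V) = F (F^[N] ∅) := by
    have := hN (N+1) (Nat.le_succ N)
    simpa [Function.iterate_succ_apply'] using this
  have hsub : lfpSet (fun X => F X) ⊆ F^[N] ∅ := by
    intro x hx
    exact hx _ (hN1.symm.subset)
  have hsub2 : ∀ n, F^[n] ∅ ⊆ lfpSet (fun X => F X) := by
    intro n
    induction n with
    | zero => exact Set.empty_subset _
    | succ n ih =>
      rw [Function.iterate_succ_apply']
      intro x hx Z hZ
      exact hZ (hFm (ih.trans (fun y hy => hy Z hZ)) hx)
  have hex : ∀ v ∈ Y, ∃ n, v ∈ F^[n] (∅ : Set V) := fun v hv => ⟨N, hsub (hY hv)⟩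
  refine ⟨fun v => if h : ∃ n, v ∈ F^[n] (∅ : Set V) then Nat.find h else 0, N, ?_, ?_⟩
  · intro v hv
    simp only [dif_pos (hex v hv)]
    refine ⟨?_, Nat.find_min' _ (hsub (hY hv))⟩
    rw [Nat.one_le_iff_ne_zero]
    intro h0
    have := Nat.find_spec (hex v hv)
    rw [h0] at this
    exact this
  · intro v hv
    have hs := Nat.find_spec (hex v hv)
    rcases hk : Nat.find (hex v hv) with _ | k
    · rw [hk] at hs; exact hs.elim
    · rw [hk, Function.iterate_succ_apply'] at hs
      refine hFm ?_ hs
      intro x hx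
      refine ⟨hY2 (hsub2 k hx), ?_⟩
      have hx' : ∃ n, x ∈ F^[n] (∅ : Set V) := ⟨k, hx⟩
      simp only [dif_pos hx', dif_pos (hex v hv), hk]
      exact Nat.lt_succ_of_le (Nat.find_min' _ hx)

theorem extProb_snoc (G : GameGraph V) (π0 π1 : List V → V → PMF V) (l : List V) (u x : V) :
    ∀ (h : List V) (v : V), extProb G π0 π1 h v (l ++ [u] ++ [x]) =
      extProb G π0 π1 h v (l ++ [u]) * stepProb G π0 π1 (h ++ [v] ++ l) u x := by
  induction l with
  | nil => intro h v; simp [extProb]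
  | cons a l ih =>
    intro h v
    have := ih (h ++ [v]) a
    simp only [List.cons_append, extProb]
    rw [this, mul_assoc]
    simp

theorem prefixProb_snoc (G : GameGraph V) (π0 π1 : List V → V → PMF V) (v : V) (l : List V)
    (u x : V) : prefixProb G π0 π1 v (l ++ [u] ++ [x]) =
      prefixProb G π0 π1 v (l ++ [u]) * stepProb G π0 π1 l u x := by
  cases l with
  | nil =>
    by_cases h : u = v
    · subst h; simp [prefixProb, extProb]
    · simp [prefixProb, h]
  | cons a l =>
    simp only [List.cons_append, prefixProb]
    split_ifs with h
    · subst h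
      rw [extProb_snoc]; simp
    · simp

theorem stepProb_sum [Fintype V] (G : GameGraph V) (hG : G.IsGameGraph)
    (π0 π1 : List V → V → PMF V) (h : List V) (u : V) :
    ∑ x, stepProb G π0 π1 h u x = 1 := by
  classical
  unfold stepProb
  split_ifs with h0 h1
  · rw [← tsum_fintype (L := SummationFilter.unconditional V)]; exact (π0 h u).tsum_coe
  · rw [← tsum_fintype (L := SummationFilter.unconditional V)]; exact (π1 h u).tsum_coe
  · rw [← Finset.sum_filter, Finset.sum_const, nsmul_eq_mul]
    have : (Finset.univ.filter (fun x => x ∈ G.E u)).card = (G.E u).ncard := by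
      rw [Set.ncard_eq_toFinset_card', Set.toFinset]
      congr 1; ext; simp
    rw [this]
    apply ENNReal.mul_inv_cancel
    · have := (Set.ncard_pos (Set.toFinite (G.E u))).2 (hG.1 u)
      exact_mod_cast this.ne'
    · simp

theorem cyl_snoc (l : List V) (r : ℕ → V) (hr : r ∈ cyl l) : r ∈ cyl (l ++ [r l.length]) := by
  intro i
  have hi := i.2
  simp only [List.length_append, List.length_singleton] at hi
  rw [List.get_eq_getElem]
  by_cases h : (i : ℕ) < l.length
  · rw [List.getElem_append_left h]; exact hr ⟨i, h⟩
  · have : (i : ℕ) = l.length := by omega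
    simp [this]

theorem cyl_last (l : List V) (u : V) (r : ℕ → V) (hr : r ∈ cyl (l ++ [u])) : r l.length = u := by
  have := hr ⟨l.length, by simp⟩
  simpa using this

/-- The exceptional event. -/
def badSet (B T : Set V) (n : ℕ) : Set (ℕ → V) :=
  {r | (∀ k, r k ∉ T) ∧ ∀ k, n ≤ k → r k ∉ B}

theorem core_bound [Fintype V] [MeasurableSpace V]
    (G : GameGraph V) (π0 π1 : List V → V → PMF V) (v : V) (P : Measure (ℕ → V))
    (hP : IsRunMeasure G π0 π1 v P) (A : Set (ℕ → V)) (h : List V) (u : V) :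
    P.real (cyl (h ++ [u]) ∩ A) ≤
      ∑ x, P.real (cyl (h ++ [u] ++ [x]) ∩ A) := by
  have := hP.1
  refine le_trans (measureReal_mono ?_) (measureReal_iUnion_fintype_le _)
  rintro r ⟨hr, hA⟩
  exact Set.mem_iUnion.2 ⟨_, cyl_snoc _ r hr, hA⟩

theorem cyl_step [MeasurableSpace V]
    (G : GameGraph V) (π0 π1 : List V → V → PMF V) (v : V) (P : Measure (ℕ → V))
    (hP : IsRunMeasure G π0 π1 v P) (h : List V) (u x : V) :
    P.real (cyl (h ++ [u] ++ [x])) =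
      P.real (cyl (h ++ [u])) * (stepProb G π0 π1 h u x).toReal := by
  simp only [Measure.real, hP.2, prefixProb_snoc, ENNReal.toReal_mul]

theorem main_null [Fintype V] [MeasurableSpace V]
    (G : GameGraph V) (hG : G.IsGameGraph) (B T Y : Set V)
    (π0 π1 : List V → V → PMF V) (v : V) (hv : v ∈ Y) (P : Measure (ℕ → V))
    (hP : IsRunMeasure G π0 π1 v P) (rk : V → ℕ) (N : ℕ)
    (hrk : ∀ v ∈ Y, 1 ≤ rk v ∧ rk v ≤ N) (p : ℝ) (hp : 0 < p) (hp1 : p ≤ 1)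
    (hcl : ∀ (h : List V), ∀ u ∈ Y, u ∉ T → ∀ x, x ∉ Y → stepProb G π0 π1 h u x = 0)
    (hpr : ∀ (h : List V), ∀ u ∈ Y, u ∉ T → u ∉ B →
      p ≤ ∑ x, if rk x < rk u then (stepProb G π0 π1 h u x).toReal else 0) (n : ℕ) :
    P (cyl [v] ∩ badSet B T n) = 0 := by
  have := hP.1
  have hsum : ∀ (h : List V) (u : V), ∑ x, (stepProb G π0 π1 h u x).toReal = 1 := by
    intro h u
    have h1 := stepProb_sum G hG π0 π1 h u
    rw [← ENNReal.toReal_sum, h1, ENNReal.toReal_one]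
    intro x _ htop
    have h2 : stepProb G π0 π1 h u x ≤ 1 := by
      rw [← h1]; exact Finset.single_le_sum (f := fun x => stepProb G π0 π1 h u x)
        (fun _ _ => zero_le) (Finset.mem_univ x)
    rw [htop] at h2
    simp at h2
  obtain ⟨ε, hε, hεp⟩ : ∃ ε : ℝ, 0 < ε ∧ p = 2 * ε := ⟨p / 2, by linarith, by ring⟩
  have hε1 : ε ≤ 1 / 2 := by linarith
  have hpow : ∀ k, ε ^ k ≤ 1 := fun k => pow_le_one₀ hε.le (by linarith)
  have hpow0 : ∀ k, 0 < ε ^ k := fun k => pow_pos hε k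
  -- drift inequality
  have drift : ∀ (h : List V), ∀ u ∈ Y, u ∉ T → u ∉ B →
      ∑ x, (stepProb G π0 π1 h u x).toReal * (1 - ε ^ rk x) ≤ (1 - ε ^ N) * (1 - ε ^ rk u) := by
    intro h u hu huT huB
    obtain ⟨h1, hN⟩ := hrk u hu
    obtain ⟨k, hk⟩ : ∃ k, rk u = k + 1 := ⟨rk u - 1, by omega⟩
    have e1 : ∑ x, (stepProb G π0 π1 h u x).toReal * (1 - ε ^ rk x) ≤
        ∑ x, ((stepProb G π0 π1 h u x).toReal -
          ε ^ k * (if rk x < rk u then (stepProb G π0 π1 h u x).toReal else 0)) := by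
      apply Finset.sum_le_sum
      intro x _
      have w0 : 0 ≤ (stepProb G π0 π1 h u x).toReal := ENNReal.toReal_nonneg
      split_ifs with hx
      · have : ε ^ k ≤ ε ^ rk x := pow_le_pow_of_le_one hε.le (by linarith) (by omega)
        nlinarith
      · nlinarith [hpow0 (rk x)]
    rw [Finset.sum_sub_distrib, hsum, ← Finset.mul_sum] at e1
    have e2 := mul_le_mul_of_nonneg_left (hpr h u hu huT huB) (hpow0 k).le
    have e3 : ε ^ k * p = 2 * ε ^ rk u := by rw [hk, hεp]; ring
    have e4 : ε ^ N ≤ ε ^ rk u := pow_le_pow_of_le_one hε.le (by linarith) hN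
    nlinarith [hpow0 N, hpow0 (rk u), mul_pos (hpow0 N) (hpow0 (rk u))]
  have lam0 : 0 ≤ 1 - ε ^ N := by linarith [hpow N]
  have lam1 : 1 - ε ^ N < 1 := by linarith [hpow0 N]
  -- geometric bound
  have geo : ∀ (m : ℕ) (h : List V), n ≤ h.length → ∀ u ∈ Y,
      P.real (cyl (h ++ [u]) ∩ badSet B T n) ≤
        P.real (cyl (h ++ [u])) * (2 * (1 - ε ^ N) ^ m * (1 - ε ^ rk u)) := by
    intro m
    induction m with
    | zero =>
      intro h hn u hu
      have e1 : P.real (cyl (h ++ [u]) ∩ badSet B T n) ≤ P.real (cyl (h ++ [u])) :=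
        measureReal_mono Set.inter_subset_left
      have e2 : ε ^ rk u ≤ ε ^ 1 := pow_le_pow_of_le_one hε.le (by linarith) (hrk u hu).1
      have e3 : 0 ≤ P.real (cyl (h ++ [u])) := measureReal_nonneg
      rw [pow_one] at e2
      rw [pow_zero]
      nlinarith
    | succ m ih =>
      intro h hn u hu
      have rhs0 : 0 ≤ P.real (cyl (h ++ [u])) * (2 * (1 - ε ^ N) ^ (m + 1) * (1 - ε ^ rk u)) := by
        have : 0 ≤ 1 - ε ^ rk u := by linarith [hpow (rk u)]
        positivity
      by_cases hS : u ∈ T ∨ u ∈ B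
      · have : cyl (h ++ [u]) ∩ badSet B T n = ∅ := by
          ext r
          simp only [Set.mem_inter_iff, Set.mem_empty_iff_false, iff_false]
          rintro ⟨hr, h1, h2⟩
          have := cyl_last h u r hr
          rcases hS with hS | hS
          · exact h1 h.length (this ▸ hS)
          · exact h2 h.length hn (this ▸ hS)
        rw [this, measureReal_empty]
        exact rhs0
      · push Not at hS
        refine (core_bound G π0 π1 v P hP _ h u).trans ?_
        have e1 : ∀ x, P.real (cyl (h ++ [u] ++ [x]) ∩ badSet B T n) ≤
            P.real (cyl (h ++ [u])) * (2 * (1 - ε ^ N) ^ m) *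
              ((stepProb G π0 π1 h u x).toReal * (1 - ε ^ rk x)) := by
          intro x
          by_cases hx : x ∈ Y
          · have := ih (h ++ [u]) (by simp; omega) x hx
            rw [cyl_step G π0 π1 v P hP] at this
            linarith
          · have := measureReal_mono (μ := P) (Set.inter_subset_left :
              cyl (h ++ [u] ++ [x]) ∩ badSet B T n ⊆ _)
            rw [cyl_step G π0 π1 v P hP, hcl h u hu hS.1 x hx] at this
            rw [hcl h u hu hS.1 x hx]
            simpa using this
        refine (Finset.sum_le_sum (fun x _ => e1 x)).trans ?_
        rw [← Finset.mul_sum]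
        refine (mul_le_mul_of_nonneg_left (drift h u hu hS.1 hS.2) ?_).trans_eq ?_
        · have : 0 ≤ P.real (cyl (h ++ [u])) := measureReal_nonneg
          positivity
        · ring
  have null1 : ∀ (h : List V), n ≤ h.length → ∀ u ∈ Y,
      P.real (cyl (h ++ [u]) ∩ badSet B T n) = 0 := by
    intro h hn u hu
    refine le_antisymm ?_ measureReal_nonneg
    have ht : Filter.Tendsto (fun m : ℕ =>
        P.real (cyl (h ++ [u])) * (2 * (1 - ε ^ N) ^ m * (1 - ε ^ rk u)))
        Filter.atTop (nhds (P.real (cyl (h ++ [u])) * (2 * 0 * (1 - ε ^ rk u)))) :=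
      (((tendsto_pow_atTop_nhds_zero_of_lt_one lam0 lam1).const_mul 2).mul_const _).const_mul _
    have := ge_of_tendsto' ht (fun m => geo m h hn u hu)
    simpa using this
  have null2 : ∀ (d : ℕ) (h : List V), n ≤ h.length + d → ∀ u ∈ Y,
      P.real (cyl (h ++ [u]) ∩ badSet B T n) = 0 := by
    intro d
    induction d with
    | zero => intro h hn u hu; exact null1 h hn u hu
    | succ d ih =>
      intro h hn u hu
      by_cases hS : u ∈ T
      · have : cyl (h ++ [u]) ∩ badSet B T n = ∅ := by
          ext r
          simp only [Set.mem_inter_iff, Set.mem_empty_iff_false, iff_false]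
          rintro ⟨hr, h1, h2⟩
          have := cyl_last h u r hr
          exact h1 h.length (this ▸ hS)
        rw [this, measureReal_empty]
      · refine le_antisymm ?_ measureReal_nonneg
        refine (core_bound G π0 π1 v P hP _ h u).trans ?_
        refine Finset.sum_nonpos (fun x _ => ?_)
        by_cases hx : x ∈ Y
        · exact (ih (h ++ [u]) (by simp; omega) x hx).le
        · have := measureReal_mono (μ := P) (Set.inter_subset_left :
              cyl (h ++ [u] ++ [x]) ∩ badSet B T n ⊆ _)
          rw [cyl_step G π0 π1 v P hP, hcl h u hu hS x hx] at this
          simpa using this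
  have := null2 n [] (by simp) v hv
  rw [measureReal_eq_zero_iff] at this
  simpa using this

end Aux

/-- Let `G` be a 2½-player game graph and `B, T ⊆ V`. Let `Y*` be the value
of the nested fixpoint `νY. μX. (Bᶜ ∩ Apre(Y, X)) ∪ (B ∩ Cpre(Y)) ∪ T`. Then for every
`v ∈ Y*` there exists a deterministic memoryless Player-0 strategy `π0` such that for every
`π1 ∈ Π1`, `P_v^{π0,π1}((□◇B) ∪ (◇T)) = 1`. -/
theorem stmt4
    {V : Type*} [Finite V] [MeasurableSpace V] [MeasurableSingletonClass V]
    (G : GameGraph V) (hG : G.IsGameGraph)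
    (B T : Set V)
    -- the family of run measures `P_v^{π0,π1}` (Ionescu–Tulcea)
    (RunM : (List V → V → PMF V) → (List V → V → PMF V) → V → Measure (ℕ → V))
    (hRunM : ∀ π0 π1, IsStrategy G π0 → IsStrategy G π1 →
      ∀ v : V, IsRunMeasure G π0 π1 v (RunM π0 π1 v))
    -- the nested fixpoint `Y*`
    (Ystar : Set V)
    (hYstar : Ystar = gfpSet (fun Y => lfpSet (fun X =>
      (Bᶜ ∩ Apre G Y X) ∪ (B ∩ Cpre G Y) ∪ T))) :
    ∀ v ∈ Ystar, ∃ π0 : List V → V → PMF V, IsStrategy G π0 ∧ IsDM π0 ∧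
      ∀ π1 : List V → V → PMF V, IsStrategy G π1 →
        RunM π0 π1 v ({r | {k | r k ∈ B}.Infinite} ∪ {r | ∃ k : ℕ, r k ∈ T}) = 1 := by
  classical
  have := Fintype.ofFinite V
  intro v hv
  have hY1 := gfp_sub G B T Ystar hYstar
  have hY2 := lfp_sub_gfp G B T Ystar hYstar
  obtain ⟨rk, N, hrk, hop⟩ := exists_rank G B T Ystar hY1 hY2
  -- the strategy
  have hf : ∀ u, ∃ x, x ∈ G.E u ∧ (u ∈ G.V0 → u ∈ Ystar → u ∉ T →
      x ∈ Ystar ∧ (u ∉ B → rk x < rk u)) := by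
    intro u
    by_cases hu : u ∈ G.V0 ∧ u ∈ Ystar ∧ u ∉ T
    · obtain ⟨h0, hY, hT⟩ := hu
      have d1 := fun h1 => Set.disjoint_left.1 hG.2.2.1 h0 h1
      have d2 := fun h1 => Set.disjoint_left.1 hG.2.2.2.1 h0 h1
      rcases hop u hY with (⟨hB, hA⟩ | ⟨hB, hC⟩) | hT'
      · rcases hA with (⟨_, x, hx1, hx2⟩ | ⟨h1, _⟩) | ⟨h1, _⟩
        · exact ⟨x, hx1, fun _ _ _ => ⟨hx2.1, fun _ => hx2.2⟩⟩
        · exact (h1.elim d1 d2).elim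
        · exact (d2 h1).elim
      · rcases hC with ⟨_, x, hx1, hx2⟩ | ⟨h1, _⟩
        · exact ⟨x, hx1, fun _ _ _ => ⟨hx2, fun h => (h hB).elim⟩⟩
        · exact (h1.elim d1 d2).elim
      · exact (hT hT').elim
    · obtain ⟨x, hx⟩ := hG.1 u
      exact ⟨x, hx, fun a b c => (hu ⟨a, b, c⟩).elim⟩
  choose f hfE hf using hf
  have hstr : IsStrategy G (fun _ u => PMF.pure (f u)) := by
    intro h u x hx
    have hx' : x = f u := by simpa using hx
    rw [hx']; exact hfE u
  refine ⟨fun _ u => PMF.pure (f u), hstr, ⟨f, fun _ _ => rfl⟩, ?_⟩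
  intro π1 hπ1
  have hP := hRunM _ π1 hstr hπ1 v
  set π0 : List V → V → PMF V := fun _ u => PMF.pure (f u) with hπ0
  set P := RunM π0 π1 v with hPdef
  have hprob := hP.1
  have hstepE : ∀ (h : List V) (u x : V), x ∉ G.E u → stepProb G π0 π1 h u x = 0 := by
    intro h u x hx
    unfold stepProb
    split_ifs with h0 h1
    · by_contra hne
      exact hx (hstr h u ((PMF.mem_support_iff _ _).2 hne))
    · by_contra hne
      exact hx (hπ1 h u ((PMF.mem_support_iff _ _).2 hne))
    · rfl
  have hstepf : ∀ (h : List V) (u x : V), u ∈ G.V0 → x ≠ f u → stepProb G π0 π1 h u x = 0 := by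
    intro h u x hu hx
    unfold stepProb
    rw [if_pos hu]
    simp [hπ0, hx]
  have hcard : 0 < Fintype.card V := Fintype.card_pos_iff.2 ⟨v⟩
  have hcl : ∀ (h : List V), ∀ u ∈ Ystar, u ∉ T → ∀ x, x ∉ Ystar →
      stepProb G π0 π1 h u x = 0 := by
    intro h u hu huT x hx
    by_cases h0 : u ∈ G.V0
    · apply hstepf h u x h0
      rintro rfl
      exact hx (hf u h0 hu huT).1
    · apply hstepE
      intro hxE
      apply hx
      rcases hop u hu with (⟨hB, hA⟩ | ⟨hB, hC⟩) | hT'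
      · rcases hA with (⟨h0', _⟩ | ⟨_, h1⟩) | ⟨_, h1, _⟩
        · exact (h0 h0').elim
        · exact (h1 hxE).1
        · exact h1 hxE
      · rcases hC with ⟨h0', _⟩ | ⟨_, h1⟩
        · exact (h0 h0').elim
        · exact h1 hxE
      · exact (huT hT').elim
  have hsum : ∀ (h : List V) (u : V), ∑ x, (stepProb G π0 π1 h u x).toReal = 1 := by
    intro h u
    have h1 := stepProb_sum G hG π0 π1 h u
    rw [← ENNReal.toReal_sum, h1, ENNReal.toReal_one]
    intro x _ htop
    have h2 : stepProb G π0 π1 h u x ≤ 1 := by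
      rw [← h1]; exact Finset.single_le_sum (f := fun x => stepProb G π0 π1 h u x)
        (fun _ _ => zero_le) (Finset.mem_univ x)
    rw [htop] at h2
    simp at h2
  have hple : ((Fintype.card V : ℝ))⁻¹ ≤ 1 := by
    apply inv_le_one_of_one_le₀; exact_mod_cast hcard
  have hpr : ∀ (h : List V), ∀ u ∈ Ystar, u ∉ T → u ∉ B →
      ((Fintype.card V : ℝ))⁻¹ ≤
        ∑ x, if rk x < rk u then (stepProb G π0 π1 h u x).toReal else 0 := by
    intro h u hu huT huB
    -- if every possible successor has smaller rank
    have all : (∀ x, stepProb G π0 π1 h u x ≠ 0 → rk x < rk u) → ((Fintype.card V : ℝ))⁻¹ ≤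
        ∑ x, if rk x < rk u then (stepProb G π0 π1 h u x).toReal else 0 := by
      intro hall
      refine hple.trans ?_
      rw [← hsum h u]
      apply Finset.sum_le_sum
      intro x _
      split_ifs with hx
      · exact le_rfl
      · have : stepProb G π0 π1 h u x = 0 := by
          by_contra hne; exact hx (hall x hne)
        simp [this]
    by_cases h0 : u ∈ G.V0
    · apply all
      intro x hx
      have : x = f u := by
        by_contra hne; exact hx (hstepf h u x h0 hne)
      rw [this]
      exact (hf u h0 hu huT).2 huB
    · rcases hop u hu with (⟨hB, hA⟩ | ⟨hB, hC⟩) | hT'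
      · rcases hA with (⟨h0', _⟩ | ⟨_, h1⟩) | ⟨hr, _, x, hxE, hx⟩
        · exact (h0 h0').elim
        · apply all
          intro x hx
          have hxE : x ∈ G.E u := by
            by_contra hne; exact hx (hstepE h u x hne)
          exact (h1 hxE).2
        · have hn1 : u ∉ G.V1 := fun h1 => Set.disjoint_left.1 hG.2.2.2.2 h1 hr
          refine le_trans ?_ (Finset.single_le_sum (f := fun x =>
            if rk x < rk u then (stepProb G π0 π1 h u x).toReal else 0) ?_ (Finset.mem_univ x))
          · have hs : stepProb G π0 π1 h u x = ((G.E u).ncard : ℝ≥0∞)⁻¹ := by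
              unfold stepProb
              rw [if_neg h0, if_neg hn1, if_pos hxE]
            have hx2 : rk x < rk u := hx.2
            simp only [hx2, if_true, hs, ENNReal.toReal_inv, ENNReal.toReal_natCast]
            have hpos := (Set.ncard_pos (Set.toFinite (G.E u))).2 (hG.1 u)
            have hle : (G.E u).ncard ≤ Fintype.card V := by
              rw [← Nat.card_eq_fintype_card]; exact Set.ncard_le_card _
            apply inv_anti₀
            · exact_mod_cast hpos
            · exact_mod_cast hle
          · intro y _
            split_ifs
            · exact ENNReal.toReal_nonneg
            · exact le_rfl
      · exact (huB hB).elim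
      · exact (huT hT').elim
  have hnull := main_null G hG B T Ystar π0 π1 v hv P hP rk N hrk _
    (inv_pos.2 (by exact_mod_cast hcard)) hple hcl hpr
  -- conclusion
  have hcyl1 : P (cyl [v]) = 1 := by
    rw [hP.2]; simp [prefixProb, extProb]
  have hU : P (⋃ n, cyl [v] ∩ badSet B T n) = 0 := measure_iUnion_null hnull
  refine le_antisymm prob_le_one ?_
  rw [← hcyl1]
  refine (measure_mono (t := ({r | {k | r k ∈ B}.Infinite} ∪ {r | ∃ k : ℕ, r k ∈ T}) ∪
    ⋃ n, cyl [v] ∩ badSet B T n) ?_).trans ((measure_union_le _ _).trans_eq (by rw [hU, add_zero]))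
  intro r hr
  by_cases h1 : {k | r k ∈ B}.Infinite
  · exact Or.inl (Or.inl h1)
  by_cases h2 : ∃ k, r k ∈ T
  · exact Or.inl (Or.inr h2)
  right
  obtain ⟨n, hn⟩ := (Set.not_infinite.1 h1).bddAbove
  refine Set.mem_iUnion.2 ⟨n + 1, hr, fun k hk => h2 ⟨k, hk⟩, fun k hk hkB => ?_⟩
  have := hn hkB
  omega
end

section
/- Let 𝔖 = (S, 𝒰, T) be a CMP, 𝒫 = (B_1, …, B_ℓ) a parity partition of S, and ρ a stationary policy. Suppose that for every odd i ∈ {1,…,ℓ} and every s ∈ B_i, P_s^ρ({w ∈ S^ℕ | ∃ m, (∀ k ≥ m, w_k ∉ B_i) or w_m ∈ ⋃_{even j, i < j ≤ ℓ} B_j}) = 1. Then for every s^0 ∈ S, P_{s^0}^ρ(𝔖 ⊨ Parity(𝒫)) = 1. -/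
open MeasureTheory

/-- Let `𝔖 = (S, 𝒰, T)` be a CMP, `𝒫 = (B_1, …, B_ℓ)` a parity partition of
`S`, and `ρ` a stationary policy. Suppose that for every odd `i ∈ {1,…,ℓ}` and every `s ∈ B_i`,
`P_s^ρ({w | ∃ m, (∀ k ≥ m, w_k ∉ B_i) or w_m ∈ ⋃_{even j, i < j ≤ ℓ} B_j}) = 1`.
Then for every `s⁰ ∈ S`, `P_{s⁰}^ρ(𝔖 ⊨ Parity(𝒫)) = 1`. -/
theorem stmt9
    {S : Type*} [MeasurableSpace S] [StandardBorelSpace S]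
    {U : Type*} [Finite U] [Nonempty U]
    (T : S → U → Measure S)
    (hT : ∀ s u, IsProbabilityMeasure (T s u))
    (hTmeas : ∀ (u : U) (A : Set S), MeasurableSet A → Measurable fun s => T s u A)
    (ρ : S → U) (hρ : ∀ u : U, MeasurableSet {s | ρ s = u})
    -- the induced family of path measures `P_s^ρ` (Ionescu–Tulcea)
    (P : S → Measure (ℕ → S))
    (hPprob : ∀ s, IsProbabilityMeasure (P s))
    (hPmeas : ∀ B : Set (ℕ → S), MeasurableSet B → Measurable fun s => P s B)
    (hP0 : ∀ s, P s {w | w 0 = s} = 1)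
    (hPMarkov : ∀ (s : S) (B : Set (ℕ → S)), MeasurableSet B →
      P s ((fun (w : ℕ → S) (n : ℕ) => w (n + 1)) ⁻¹' B) = ∫⁻ t, P t B ∂(T s (ρ s)))
    -- the parity partition `𝒫 = (B_1, …, B_ℓ)`
    (ℓ : ℕ) (B : ℕ → Set S)
    (hBmeas : ∀ i ∈ Finset.Icc 1 ℓ, MeasurableSet (B i))
    (hBdisj : ∀ i ∈ Finset.Icc 1 ℓ, ∀ j ∈ Finset.Icc 1 ℓ, i ≠ j → Disjoint (B i) (B j))
    (hBcover : ⋃ i ∈ Finset.Icc 1 ℓ, B i = Set.univ)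
    -- the local reachability hypothesis at every state of odd priority
    (hlocal : ∀ i ∈ Finset.Icc 1 ℓ, Odd i → ∀ s ∈ B i,
      P s {w | ∃ m : ℕ, (∀ k ≥ m, w k ∉ B i) ∨
        w m ∈ ⋃ j ∈ Finset.Icc (i + 1) ℓ, ⋃ (_ : Even j), B j} = 1) :
    ∀ s0 : S,
      P s0 {w | ∀ i ∈ Finset.Icc 1 ℓ, Odd i → {k | w k ∈ B i}.Infinite →
        ∃ j ∈ Finset.Icc (i + 1) ℓ, Even j ∧ {k | w k ∈ B j}.Infinite} = 1 := by
  intro s0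
  have hmeasE : ∀ i, 1 ≤ i →
      MeasurableSet (⋃ j ∈ Finset.Icc (i + 1) ℓ, ⋃ (_ : Even j), B j) := by
    intro i hi
    refine Finset.measurableSet_biUnion _ fun j hj => MeasurableSet.iUnion fun _ => hBmeas j ?_
    rw [Finset.mem_Icc] at hj ⊢
    omega
  set N : ℕ → Set (ℕ → S) := fun i => {w | w 0 ∈ B i ∧ (∀ m, ∃ k, m ≤ k ∧ w k ∈ B i) ∧
    ∀ m, w m ∉ ⋃ j ∈ Finset.Icc (i + 1) ℓ, ⋃ (_ : Even j), B j} with hN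
  have hev : ∀ (A : Set S), MeasurableSet A → ∀ k, MeasurableSet {w : ℕ → S | w k ∈ A} :=
    fun A hA k => measurable_pi_apply k hA
  have hio : ∀ i ∈ Finset.Icc 1 ℓ,
      MeasurableSet {w : ℕ → S | ∀ m, ∃ k, m ≤ k ∧ w k ∈ B i} := by
    intro i hi
    simp only [Set.setOf_forall, Set.setOf_exists]
    refine MeasurableSet.iInter fun m => MeasurableSet.iUnion fun k => ?_
    exact (MeasurableSet.const (m ≤ k)).inter (hev _ (hBmeas i hi) k)
  have hnev : ∀ i, 1 ≤ i → MeasurableSet {w : ℕ → S | ∀ m,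
      w m ∉ ⋃ j ∈ Finset.Icc (i + 1) ℓ, ⋃ (_ : Even j), B j} := by
    intro i hi
    simp only [Set.setOf_forall]
    exact MeasurableSet.iInter fun m => (hev _ (hmeasE i hi) m).compl
  have hNmeas : ∀ i ∈ Finset.Icc 1 ℓ, MeasurableSet (N i) := by
    intro i hi
    exact (hev _ (hBmeas i hi) 0).inter ((hio i hi).inter (hnev i (Finset.mem_Icc.1 hi).1))
  have hN0 : ∀ i ∈ Finset.Icc 1 ℓ, Odd i → ∀ s, P s (N i) = 0 := by
    intro i hi hodd s
    have := hPprob s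
    by_cases hs : s ∈ B i
    · have h1 := hlocal i hi hodd s hs
      have hset : {w : ℕ → S | ∃ m : ℕ, (∀ k ≥ m, w k ∉ B i) ∨
          w m ∈ ⋃ j ∈ Finset.Icc (i + 1) ℓ, ⋃ (_ : Even j), B j} =
          ({w : ℕ → S | ∀ m, ∃ k, m ≤ k ∧ w k ∈ B i} ∩ {w : ℕ → S | ∀ m,
            w m ∉ ⋃ j ∈ Finset.Icc (i + 1) ℓ, ⋃ (_ : Even j), B j})ᶜ := by
        ext w
        simp only [Set.mem_ofPred_eq, Set.mem_compl_iff, Set.mem_inter_iff, not_and_or, not_forall,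
          not_exists, not_not, exists_or, ge_iff_le, imp_iff_not_or]
      rw [hset] at h1
      have hm := (hio i hi).inter (hnev i (Finset.mem_Icc.1 hi).1)
      have h2 := (prob_compl_eq_one_iff hm).1 h1
      exact measure_mono_null (fun w hw => hw.2) h2
    · have hm : MeasurableSet {w : ℕ → S | w 0 = s} :=
        hev {s} (measurableSet_singleton s) 0
      have h2 := (prob_compl_eq_zero_iff hm).2 (hP0 s)
      refine measure_mono_null (fun w hw => ?_) h2
      intro h
      apply hs
      have h' : w 0 = s := h
      exact h' ▸ hw.1
  have hshift : ∀ i ∈ Finset.Icc 1 ℓ, Odd i → ∀ n s,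
      P s ((fun (w : ℕ → S) (k : ℕ) => w (k + n)) ⁻¹' N i) = 0 := by
    intro i hi hodd n
    induction n with
    | zero => exact hN0 i hi hodd
    | succ n ih =>
      intro s
      have hm : MeasurableSet ((fun (w : ℕ → S) (k : ℕ) => w (k + n)) ⁻¹' N i) :=
        (measurable_pi_lambda _ fun k => measurable_pi_apply (k + n)) (hNmeas i hi)
      have h := hPMarkov s _ hm
      simp only [ih, lintegral_zero] at h
      exact h
  have := hPprob s0
  have hae : ∀ᵐ w ∂(P s0), ∀ i n, i ∈ Finset.Icc 1 ℓ → Odd i →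
      (fun k => w (k + n)) ∉ N i := by
    rw [ae_all_iff]; intro i
    rw [ae_all_iff]; intro n
    by_cases hi : i ∈ Finset.Icc 1 ℓ
    · by_cases ho : Odd i
      · have h := measure_eq_zero_iff_ae_notMem.1 (hshift i hi ho n s0)
        filter_upwards [h] with w hw _ _ using hw
      · exact Filter.Eventually.of_forall fun w _ h => absurd h ho
    · exact Filter.Eventually.of_forall fun w h => absurd h hi
  rw [← measure_univ (μ := P s0)]
  refine measure_congr (Filter.eventuallyEq_univ.2 ?_)
  filter_upwards [hae] with w hw
  intro i hi hodd hinf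
  by_contra hcon
  push Not at hcon
  have hfin : (⋃ j ∈ Finset.Icc (i + 1) ℓ, ⋃ (_ : Even j), {k | w k ∈ B j}).Finite := by
    refine Set.Finite.biUnion (Finset.finite_toSet _) fun j hj => ?_
    refine Set.finite_iUnion fun he => ?_
    simpa using hcon j hj he
  obtain ⟨M, hM⟩ := hfin.bddAbove
  obtain ⟨n, hn, hMn⟩ := hinf.exists_gt M
  refine hw i n hi hodd ⟨?_, ?_, ?_⟩
  · simpa using hn
  · intro m
    obtain ⟨k, hk, hmk⟩ := hinf.exists_gt (m + n)
    refine ⟨k - n, by omega, ?_⟩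
    have : k - n + n = k := by omega
    simpa [this] using hk
  · intro m hm
    have : m + n ≤ M := hM (by simpa using hm)
    omega
end

section
/- Let ⟨G, 𝒫̂⟩ be a 2½-player parity game with parity partition 𝒫̂ = (B̂_1, …, B̂_ℓ) of V, let v^0 ∈ V, and let π_0* ∈ Π_0^DM be a deterministic memoryless Player-0 strategy with inf_{π_1 ∈ Π_1} P_{v^0}^{π_0*,π_1}(Parity(𝒫̂)) = 1. Then for every finite run v^0 v^1 ⋯ v^n such that there exists π_1 ∈ Π_1 with P_{v^0}^{π_0*,π_1}({r ∈ V^ℕ | r_0 = v^0, …, r_n = v^n}) > 0, and for every odd i ∈ {1,…,ℓ} with v^n ∈ B̂_i: inf_{π_1 ∈ Π_1} P_{v^n}^{π_0*,π_1}({r ∈ V^ℕ | ∃ m, (∀ k ≥ m, r_k ∉ B̂_i) or r_m ∈ ⋃_{even j, i < j ≤ ℓ} B̂_j}) = 1. -/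
open MeasureTheory
open scoped ENNReal

/-- The parity winning condition `Parity(𝒫̂)` on runs. -/
def parityEvent {V : Type*} (ℓ : ℕ) (B : ℕ → Set V) : Set (ℕ → V) :=
  {r | ∀ i ∈ Finset.Icc 1 ℓ, Odd i → {k | r k ∈ B i}.Infinite →
    ∃ j ∈ Finset.Icc (i + 1) ℓ, Even j ∧ {k | r k ∈ B j}.Infinite}

/-! ### Cylinders -/

theorem mem_cyl_iff {V : Type*} (l : List V) (r : ℕ → V) :
    r ∈ cyl l ↔ ∀ (i : ℕ) (h : i < l.length), r i = l[i] := by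
  constructor
  · intro h i hi
    exact h ⟨i, hi⟩
  · intro h i
    exact h i.1 i.2

theorem measurableSet_cyl {V : Type*} [MeasurableSpace V] [MeasurableSingletonClass V]
    (l : List V) : MeasurableSet (cyl l) := by
  have : cyl l = ⋂ i : Fin l.length, (fun r : ℕ → V => r i) ⁻¹' {l.get i} := by
    ext r; simp [cyl]
  rw [this]
  exact MeasurableSet.iInter fun i => (measurable_pi_apply _) (measurableSet_singleton _)

theorem cyl_subset_of_mem {V : Type*} (l l' : List V) (hl : l.length ≤ l'.length)
    (r : ℕ → V) (h : r ∈ cyl l) (h' : r ∈ cyl l') : cyl l' ⊆ cyl l := by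
  intro s hs
  rw [mem_cyl_iff] at *
  intro i hi
  rw [hs i (by omega), ← h' i (by omega), h i hi]

theorem isPiSystem_cyl {V : Type*} : IsPiSystem (Set.range (cyl (V := V))) := by
  rintro _ ⟨l, rfl⟩ _ ⟨l', rfl⟩ ⟨r, h, h'⟩
  rcases le_total l.length l'.length with hl | hl
  · exact ⟨l', (Set.inter_eq_right.2 (cyl_subset_of_mem l l' hl r h h')).symm⟩
  · exact ⟨l, (Set.inter_eq_left.2 (cyl_subset_of_mem l' l hl r h' h)).symm⟩

theorem generateFrom_cyl {V : Type*} [Finite V] [MeasurableSpace V] [MeasurableSingletonClass V] :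
    (MeasurableSpace.pi : MeasurableSpace (ℕ → V)) =
      MeasurableSpace.generateFrom (Set.range (cyl (V := V))) := by
  apply le_antisymm
  · refine iSup_le fun k => ?_
    rintro _ ⟨A, -, rfl⟩
    have : (fun r : ℕ → V => r k) ⁻¹' A =
        ⋃ l : {l : List V // ∃ h : k < l.length, l[k] ∈ A}, cyl l.1 := by
      ext r
      simp only [Set.mem_preimage, Set.mem_iUnion]
      constructor
      · intro hr
        refine ⟨⟨List.ofFn (fun i : Fin (k+1) => r i), by simp, by rw [List.getElem_ofFn]; exact hr⟩, ?_⟩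
        rw [mem_cyl_iff]
        intro i hi
        rw [List.getElem_ofFn]
      · rintro ⟨⟨l, hk, hA⟩, hr⟩
        rw [mem_cyl_iff] at hr
        rw [hr k hk]; exact hA
    change MeasurableSet[MeasurableSpace.generateFrom (Set.range (cyl (V := V)))] _
    rw [this]
    have : Countable V := Finite.to_countable
    exact MeasurableSet.iUnion fun l => MeasurableSpace.measurableSet_generateFrom ⟨l.1, rfl⟩
  · apply MeasurableSpace.generateFrom_le
    rintro _ ⟨l, rfl⟩
    exact measurableSet_cyl l

/-! ### Finite-run probabilities -/

theorem extProb_append {V : Type*} (G : GameGraph V) (π0 π1 : List V → V → PMF V)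
    (a b : List V) : ∀ (h : List V) (v : V),
    extProb G π0 π1 h v (a ++ b) = extProb G π0 π1 h v a *
      extProb G π0 π1 (h ++ (v :: a).dropLast) ((v :: a).getLast (by simp)) b := by
  induction a with
  | nil => intro h v; simp [extProb]
  | cons x a ih =>
    intro h v
    simp only [List.cons_append, extProb]
    rw [ih, mul_assoc]
    simp

open scoped Classical in
/-- Play `σ` for the first `d` moves, then forget the past and play `τ`. -/
noncomputable def switchStrat {V : Type*} (d : ℕ) (σ τ : List V → V → PMF V) :
    List V → V → PMF V :=
  fun h v => if h.length < d then σ h v else τ (h.drop d) v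

theorem extProb_switch_lt {V : Type*} (G : GameGraph V) (π0 σ τ : List V → V → PMF V) (d : ℕ)
    (a : List V) : ∀ (h : List V) (v : V), h.length + a.length ≤ d →
    extProb G π0 (switchStrat d σ τ) h v a = extProb G π0 σ h v a := by
  induction a with
  | nil => intro h v _; simp [extProb]
  | cons x a ih =>
    intro h v hd
    simp only [List.length_cons] at hd
    simp only [extProb]
    rw [ih _ _ (by simp; omega)]
    simp only [stepProb, switchStrat]
    rw [if_pos (by omega : h.length < d)]

theorem extProb_switch_ge {V : Type*} (G : GameGraph V) (π0 σ τ : List V → V → PMF V)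
    (hDM : IsDM π0) (d : ℕ)
    (a : List V) : ∀ (h : List V) (v : V), d ≤ h.length →
    extProb G π0 (switchStrat d σ τ) h v a = extProb G π0 τ (h.drop d) v a := by
  obtain ⟨f, hf⟩ := hDM
  induction a with
  | nil => intro h v _; simp [extProb]
  | cons x a ih =>
    intro h v hd
    simp only [extProb]
    rw [ih _ _ (by simp; omega), List.drop_append_of_le_length hd]
    simp only [stepProb, switchStrat, hf]
    rw [if_neg (by omega : ¬ h.length < d)]

/-- The shifted run measure restricted to a cylinder is a multiple of the run measure. -/
theorem map_shift_eq {V : Type*} [Finite V] [MeasurableSpace V] [MeasurableSingletonClass V]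
    (G : GameGraph V) (π0 σ τ : List V → V → PMF V) (hDM : IsDM π0)
    (v : V) (t : List V) (P Q : Measure (ℕ → V))
    (hP : IsRunMeasure G π0 (switchStrat t.length σ τ) v P)
    (hQ : IsRunMeasure G π0 τ ((v :: t).getLast (by simp)) Q) :
    (P.restrict (cyl (v :: t))).map (fun r k => r (t.length + k)) = P (cyl (v :: t)) • Q := by
  have := hP.1
  have := hQ.1
  have hmeas : Measurable (fun (r : ℕ → V) (k : ℕ) => r (t.length + k)) :=
    measurable_pi_lambda _ fun k => measurable_pi_apply _
  refine ext_of_generate_finite _ generateFrom_cyl isPiSystem_cyl ?_ ?_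
  · rintro _ ⟨w, rfl⟩
    rw [Measure.map_apply hmeas (measurableSet_cyl w),
      Measure.restrict_apply (hmeas (measurableSet_cyl w)), Measure.smul_apply, hQ.2 w,
      smul_eq_mul]
    cases w with
    | nil =>
      have : cyl ([] : List V) = Set.univ := by ext r; simp [mem_cyl_iff]
      simp [this, prefixProb]
    | cons x w =>
      simp only [prefixProb]
      split_ifs with hx
      · have hset : (fun (r : ℕ → V) (k : ℕ) => r (t.length + k)) ⁻¹' cyl (x :: w) ∩ cyl (v :: t)
            = cyl (v :: (t ++ w)) := by
          ext r
          simp only [Set.mem_inter_iff, Set.mem_preimage, mem_cyl_iff]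
          constructor
          · rintro ⟨h1, h2⟩ i hi
            by_cases hit : i < (v :: t).length
            · rw [h2 i hit]
              simp only [← List.cons_append]
              rw [List.getElem_append_left]
            · have h3 := h1 (i - t.length) (by simp at hi hit ⊢; omega)
              simp only [List.length_cons, not_lt] at hit
              rw [show t.length + (i - t.length) = i by omega] at h3
              rw [h3]
              simp only [← List.cons_append]
              rw [List.getElem_append_right (by simpa using hit), List.getElem_cons,
                dif_neg (by omega)]
              congr 1
              all_goals (simp; omega)
          · intro h
            have h2 : ∀ (i : ℕ) (hi : i < (v :: t).length), r i = (v :: t)[i] := by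
              intro i hi
              rw [h i (by simp at hi ⊢; omega)]
              simp only [← List.cons_append]
              rw [List.getElem_append_left]
            refine ⟨?_, h2⟩
            intro i hi
            cases i with
            | zero =>
              simp only [Nat.add_zero]
              rw [h2 _ (by simp)]
              simp [hx, List.getLast_eq_getElem]
            | succ i =>
              simp only [List.length_cons] at hi
              rw [h (t.length + (i+1)) (by simp; omega)]
              simp only [← List.cons_append]
              rw [List.getElem_append_right (by simp)]
              simp only [List.getElem_cons_succ, List.length_cons]
              congr 1
              omega
        rw [hset, hP.2, hP.2]
        simp only [prefixProb, if_true]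
        rw [extProb_append]
        congr 1
        rw [extProb_switch_ge G π0 σ τ hDM _ _ _ _ (by simp)]
        congr 1
        simp
      · have hset : (fun (r : ℕ → V) (k : ℕ) => r (t.length + k)) ⁻¹' cyl (x :: w) ∩ cyl (v :: t)
            = ∅ := by
          rw [Set.eq_empty_iff_forall_notMem]
          rintro r ⟨h1, h2⟩
          rw [Set.mem_preimage, mem_cyl_iff] at h1
          rw [mem_cyl_iff] at h2
          apply hx
          have e1 := h1 0 (by simp)
          have e2 := h2 t.length (by simp)
          simp only [Nat.add_zero, List.getElem_cons_zero] at e1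
          rw [← e1, e2, List.getLast_eq_getElem]
          simp
        simp [hset]
  · rw [Measure.map_apply hmeas MeasurableSet.univ]
    simp

theorem measurableSet_infinite {V : Type*} [Finite V] [MeasurableSpace V]
    [MeasurableSingletonClass V] (A : Set V) :
    MeasurableSet {r : ℕ → V | {k | r k ∈ A}.Infinite} := by
  have hA : MeasurableSet A := A.toFinite.measurableSet
  have : {r : ℕ → V | {k | r k ∈ A}.Infinite} =
      ⋂ n : ℕ, ⋃ k : ℕ, ⋃ _ : n < k, (fun r : ℕ → V => r k) ⁻¹' A := by
    ext r
    simp only [Set.mem_ofPred_eq, Set.mem_iInter, Set.mem_iUnion, Set.mem_preimage]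
    constructor
    · intro h n
      obtain ⟨k, hk, hn⟩ := h.exists_gt n
      exact ⟨k, hn, hk⟩
    · intro h
      refine Set.infinite_of_forall_exists_gt fun n => ?_
      obtain ⟨k, hn, hk⟩ := h n
      exact ⟨k, hk, hn⟩
  rw [this]
  exact MeasurableSet.iInter fun n => MeasurableSet.iUnion fun k => MeasurableSet.iUnion fun _ =>
    (measurable_pi_apply k) hA

theorem measurableSet_parity {V : Type*} [Finite V] [MeasurableSpace V]
    [MeasurableSingletonClass V] (ℓ : ℕ) (B : ℕ → Set V) :
    MeasurableSet (parityEvent ℓ B) := by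
  have : parityEvent ℓ B = ⋂ i : ℕ, ⋂ _ : i ∈ Finset.Icc 1 ℓ, ⋂ _ : Odd i,
      ({r : ℕ → V | {k | r k ∈ B i}.Infinite}ᶜ ∪
        ⋃ j : ℕ, ⋃ _ : j ∈ Finset.Icc (i + 1) ℓ, ⋃ _ : Even j,
          {r : ℕ → V | {k | r k ∈ B j}.Infinite}) := by
    ext r
    simp only [parityEvent, Set.mem_ofPred_eq, Set.mem_iInter, Set.mem_union, Set.mem_compl_iff,
      Set.mem_iUnion, exists_prop, imp_iff_not_or]
  rw [this]
  exact MeasurableSet.iInter fun i => MeasurableSet.iInter fun _ => MeasurableSet.iInter fun _ =>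
    (measurableSet_infinite _).compl.union <| MeasurableSet.iUnion fun j =>
      MeasurableSet.iUnion fun _ => MeasurableSet.iUnion fun _ => measurableSet_infinite _

theorem measurableSet_good {V : Type*} [Finite V] [MeasurableSpace V]
    [MeasurableSingletonClass V] (A C : Set V) :
    MeasurableSet {r : ℕ → V | ∃ m : ℕ, (∀ k ≥ m, r k ∉ A) ∨ r m ∈ C} := by
  have hA : MeasurableSet A := A.toFinite.measurableSet
  have hC : MeasurableSet C := C.toFinite.measurableSet
  have : {r : ℕ → V | ∃ m : ℕ, (∀ k ≥ m, r k ∉ A) ∨ r m ∈ C} =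
      ⋃ m : ℕ, ((⋂ k : ℕ, ⋂ _ : k ≥ m, (fun r : ℕ → V => r k) ⁻¹' Aᶜ) ∪
        (fun r : ℕ → V => r m) ⁻¹' C) := by
    ext r
    simp
  rw [this]
  exact MeasurableSet.iUnion fun m => (MeasurableSet.iInter fun k => MeasurableSet.iInter fun _ =>
    (measurable_pi_apply k) hA.compl).union ((measurable_pi_apply m) hC)

/-- Let `⟨G, 𝒫̂⟩` be a 2½-player parity game, `v⁰ ∈ V`, and `π0* ∈ Π0^DM`
a deterministic memoryless Player-0 strategy with
`inf_{π1 ∈ Π1} P_{v⁰}^{π0*,π1}(Parity(𝒫̂)) = 1`. Then for every finite run `v⁰ v¹ ⋯ vⁿ`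
with positive probability under some `π1 ∈ Π1`, and for every odd `i ∈ {1,…,ℓ}` with
`vⁿ ∈ B̂_i`:
`inf_{π1 ∈ Π1} P_{vⁿ}^{π0*,π1}({r | ∃ m, (∀ k ≥ m, r_k ∉ B̂_i) or
r_m ∈ ⋃_{even j, i < j ≤ ℓ} B̂_j}) = 1`. -/
theorem stmt11
    {V : Type*} [Finite V] [MeasurableSpace V] [MeasurableSingletonClass V]
    (G : GameGraph V) (hG : G.IsGameGraph)
    (ℓ : ℕ) (B : ℕ → Set V)
    (hBdisj : ∀ i ∈ Finset.Icc 1 ℓ, ∀ j ∈ Finset.Icc 1 ℓ, i ≠ j → Disjoint (B i) (B j))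
    (hBcover : ⋃ i ∈ Finset.Icc 1 ℓ, B i = Set.univ)
    -- the family of run measures `P_v^{π0,π1}` (Ionescu–Tulcea)
    (RunM : (List V → V → PMF V) → (List V → V → PMF V) → V → Measure (ℕ → V))
    (hRunM : ∀ π0 π1, IsStrategy G π0 → IsStrategy G π1 →
      ∀ v : V, IsRunMeasure G π0 π1 v (RunM π0 π1 v))
    -- a deterministic memoryless Player-0 strategy winning almost surely from `v⁰`
    (v0 : V)
    (π0 : List V → V → PMF V) (hπ0 : IsStrategy G π0) (hDM : IsDM π0)
    (hwin : ⨅ π1 : {σ : List V → V → PMF V // IsStrategy G σ},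
      RunM π0 π1.1 v0 (parityEvent ℓ B) = 1) :
    ∀ (l : List V) (hne : l ≠ []), l.head hne = v0 →
      (∃ π1 : List V → V → PMF V, IsStrategy G π1 ∧ 0 < RunM π0 π1 v0 (cyl l)) →
      ∀ i ∈ Finset.Icc 1 ℓ, Odd i → l.getLast hne ∈ B i →
        ⨅ π1 : {σ : List V → V → PMF V // IsStrategy G σ},
          RunM π0 π1.1 (l.getLast hne)
            {r | ∃ m : ℕ, (∀ k ≥ m, r k ∉ B i) ∨
              r m ∈ ⋃ j ∈ Finset.Icc (i + 1) ℓ, ⋃ (_ : Even j), B j} = 1 := by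
  intro l hne hhead hpos i hi hodd hlast
  obtain ⟨σ, hσ, hposσ⟩ := hpos
  obtain ⟨v, t, rfl⟩ : ∃ v t, l = v :: t := List.exists_cons_of_ne_nil hne
  simp only [List.head_cons] at hhead
  subst hhead
  have key : ∀ τ, IsStrategy G τ → RunM π0 τ ((v :: t).getLast hne)
      {r | ∃ m : ℕ, (∀ k ≥ m, r k ∉ B i) ∨
              r m ∈ ⋃ j ∈ Finset.Icc (i + 1) ℓ, ⋃ (_ : Even j), B j} = 1 := by
    intro τ hτ
    have hsw : IsStrategy G (switchStrat t.length σ τ) := by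
      intro h w
      simp only [switchStrat]
      split_ifs
      · exact hσ _ _
      · exact hτ _ _
    have hP := hRunM π0 _ hπ0 hsw v
    have hQ := hRunM π0 _ hπ0 hτ ((v :: t).getLast hne)
    have hS := hRunM π0 _ hπ0 hσ v
    have hmap := map_shift_eq G π0 σ τ hDM v t _ _ hP hQ
    set P := RunM π0 (switchStrat t.length σ τ) v
    set Q := RunM π0 τ ((v :: t).getLast hne)
    have := hP.1
    have := hQ.1
    have hcyl : P (cyl (v :: t)) ≠ 0 := by
      rw [hP.2]
      rw [hS.2] at hposσ
      simp only [prefixProb, if_true] at hposσ ⊢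
      rw [extProb_switch_lt _ _ _ _ _ _ _ _ (by simp)]
      exact hposσ.ne'
    have hpar : P (parityEvent ℓ B) = 1 := by
      apply le_antisymm prob_le_one
      rw [← hwin]
      exact iInf_le (fun π1 : {σ : List V → V → PMF V // IsStrategy G σ} =>
        RunM π0 π1.1 v (parityEvent ℓ B)) ⟨_, hsw⟩
    have hpar0 : P (parityEvent ℓ B)ᶜ = 0 :=
      (prob_compl_eq_zero_iff (measurableSet_parity ℓ B)).2 hpar
    set C := ⋃ j ∈ Finset.Icc (i + 1) ℓ, ⋃ (_ : Even j), B j with hC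
    have hgood := measurableSet_good (B i) C
    rw [← prob_compl_eq_zero_iff hgood]
    have hmeas : Measurable (fun (r : ℕ → V) (k : ℕ) => r (t.length + k)) :=
      measurable_pi_lambda _ fun k => measurable_pi_apply _
    have h1 := congrArg (fun μ => μ {r : ℕ → V | ∃ m : ℕ, (∀ k ≥ m, r k ∉ B i) ∨ r m ∈ C}ᶜ) hmap
    simp only [Measure.smul_apply, smul_eq_mul] at h1
    rw [Measure.map_apply hmeas hgood.compl, Measure.restrict_apply (hmeas hgood.compl)] at h1
    have h0 : P ((fun (r : ℕ → V) (k : ℕ) => r (t.length + k)) ⁻¹'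
        {r : ℕ → V | ∃ m : ℕ, (∀ k ≥ m, r k ∉ B i) ∨ r m ∈ C}ᶜ ∩ cyl (v :: t)) = 0 := by
      refine measure_mono_null ?_ hpar0
      rintro r ⟨hr, -⟩ hrp
      simp only [Set.mem_preimage, Set.mem_compl_iff, Set.mem_ofPred_eq, not_exists, not_or,
        not_forall, not_not] at hr
      have hinf : {k | r k ∈ B i}.Infinite := by
        refine Set.infinite_of_forall_exists_gt fun n => ?_
        obtain ⟨k, hk, hkB⟩ := (hr (n + 1)).1
        exact ⟨t.length + k, hkB, by omega⟩
      obtain ⟨j, hj, hje, hjinf⟩ := hrp i hi hodd hinf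
      obtain ⟨k, hk, hkt⟩ := hjinf.exists_gt t.length
      apply (hr (k - t.length)).2
      rw [show t.length + (k - t.length) = k by omega, hC]
      simp only [Set.mem_iUnion]
      exact ⟨j, hj, hje, hk⟩
    rw [h0] at h1
    exact (mul_eq_zero.1 h1.symm).resolve_left hcyl
  have : Nonempty {σ : List V → V → PMF V // IsStrategy G σ} := ⟨⟨σ, hσ⟩⟩
  refine (iInf_congr (fun π1 : {σ : List V → V → PMF V // IsStrategy G σ} =>
    key π1.1 π1.2)).trans ?_
  exact iInf_const
end

section
/- Let 𝔖 = (S, 𝒰, T) be a CMP, ρ a stationary policy, A ⊆ S measurable, and ε > 0 such that T(A | s, ρ(s)) ≤ 1 − ε for every s ∈ A. Then for every s ∈ S, P_s^ρ(𝔖 ⊨ □A) = 0. -/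
open MeasureTheory
open scoped ENNReal

/-- Let `𝔖 = (S, 𝒰, T)` be a CMP, `ρ` a stationary policy, `A ⊆ S`
measurable, and `ε > 0` such that `T(A | s, ρ(s)) ≤ 1 − ε` for every `s ∈ A`. Then for every
`s ∈ S`, `P_s^ρ(𝔖 ⊨ □A) = 0`. -/
theorem stmt17
    {S : Type*} [MeasurableSpace S] [StandardBorelSpace S]
    {U : Type*} [Finite U] [Nonempty U]
    (T : S → U → Measure S)
    (hT : ∀ s u, IsProbabilityMeasure (T s u))
    (hTmeas : ∀ (u : U) (A : Set S), MeasurableSet A → Measurable fun s => T s u A)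
    (ρ : S → U) (hρ : ∀ u : U, MeasurableSet {s | ρ s = u})
    -- the induced family of path measures `P_s^ρ` (Ionescu–Tulcea)
    (P : S → Measure (ℕ → S))
    (hPprob : ∀ s, IsProbabilityMeasure (P s))
    (hPmeas : ∀ B : Set (ℕ → S), MeasurableSet B → Measurable fun s => P s B)
    (hP0 : ∀ s, P s {w | w 0 = s} = 1)
    (hPMarkov : ∀ (s : S) (B : Set (ℕ → S)), MeasurableSet B →
      P s ((fun (w : ℕ → S) (n : ℕ) => w (n + 1)) ⁻¹' B) = ∫⁻ t, P t B ∂(T s (ρ s)))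
    (A : Set S) (hA : MeasurableSet A)
    (ε : ℝ≥0∞) (hε : 0 < ε)
    (hleak : ∀ s ∈ A, T s (ρ s) A ≤ 1 - ε) :
    ∀ s : S, P s {w | ∀ n : ℕ, w n ∈ A} = 0 := by
  classical
  set E : Set (ℕ → S) := {w | ∀ n : ℕ, w n ∈ A} with hE
  have hEm : MeasurableSet E := by
    have : E = ⋂ n : ℕ, (fun w : ℕ → S => w n) ⁻¹' A := by
      ext w; simp [hE]
    rw [this]
    exact MeasurableSet.iInter fun n => measurable_pi_apply n hA
  have hout : ∀ s, s ∉ A → P s E = 0 := by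
    intro s hs
    have := hPprob s
    have hm : MeasurableSet {w : ℕ → S | w 0 = s} :=
      measurable_pi_apply (X := fun _ : ℕ => S) 0 (measurableSet_singleton s)
    have h0 : P s {w : ℕ → S | w 0 = s}ᶜ = 0 := (prob_compl_eq_zero_iff hm).2 (hP0 s)
    refine measure_mono_null ?_ h0
    intro w hw h
    have h' : w 0 = s := h
    exact hs (h' ▸ hw 0)
  have hpow : ∀ n : ℕ, ∀ s, P s E ≤ (1 - ε) ^ n := by
    intro n
    induction n with
    | zero =>
      intro s
      have := hPprob s
      simpa using prob_le_one (μ := P s) (s := E)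
    | succ n ih =>
      intro s
      by_cases hs : s ∈ A
      · calc P s E ≤ P s ((fun (w : ℕ → S) (n : ℕ) => w (n + 1)) ⁻¹' E) :=
              measure_mono fun w hw n => hw (n + 1)
          _ = ∫⁻ t, P t E ∂(T s (ρ s)) := hPMarkov s E hEm
          _ ≤ ∫⁻ t, A.indicator (fun _ => (1 - ε) ^ n) t ∂(T s (ρ s)) := by
              refine lintegral_mono fun t => ?_
              by_cases ht : t ∈ A
              · simpa [ht] using ih t
              · simp [ht, hout t ht]
          _ = (1 - ε) ^ n * T s (ρ s) A := lintegral_indicator_const hA _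
          _ ≤ (1 - ε) ^ n * (1 - ε) := by gcongr; exact hleak s hs
          _ = (1 - ε) ^ (n + 1) := (pow_succ _ _).symm
      · simp [hout s hs]
  intro s
  have hlt : 1 - ε < 1 := ENNReal.sub_lt_self ENNReal.one_ne_top one_ne_zero hε.ne'
  exact le_antisymm (ge_of_tendsto' (ENNReal.tendsto_pow_atTop_nhds_zero_of_lt_one hlt)
    fun n => hpow n s) zero_le
end

section
/- Let 𝔖 = (S, 𝒰, T) be a CMP, ρ a stationary policy, A, B ⊆ S disjoint measurable sets, and ε > 0 such that T(B | s, ρ(s)) ≥ ε for every s ∈ A. Then for every s^0 ∈ S, P_{s^0}^ρ({w ∈ S^ℕ | w_k ∈ A for infinitely many k, and w_k ∉ B for all k}) = 0. -/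
open MeasureTheory
open scoped ENNReal

/-- Let `𝔖 = (S, 𝒰, T)` be a CMP, `ρ` a stationary policy, `A, B ⊆ S`
disjoint measurable sets, and `ε > 0` such that `T(B | s, ρ(s)) ≥ ε` for every `s ∈ A`. Then
for every `s⁰ ∈ S`,
`P_{s⁰}^ρ({w | w_k ∈ A for infinitely many k, and w_k ∉ B for all k}) = 0`. -/
theorem stmt18
    {S : Type*} [MeasurableSpace S] [StandardBorelSpace S]
    {U : Type*} [Finite U] [Nonempty U]
    (T : S → U → Measure S)
    (hT : ∀ s u, IsProbabilityMeasure (T s u))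
    (hTmeas : ∀ (u : U) (A : Set S), MeasurableSet A → Measurable fun s => T s u A)
    (ρ : S → U) (hρ : ∀ u : U, MeasurableSet {s | ρ s = u})
    -- the induced family of path measures `P_s^ρ` (Ionescu–Tulcea)
    (P : S → Measure (ℕ → S))
    (hPprob : ∀ s, IsProbabilityMeasure (P s))
    (hPmeas : ∀ B : Set (ℕ → S), MeasurableSet B → Measurable fun s => P s B)
    (hP0 : ∀ s, P s {w | w 0 = s} = 1)
    (hPMarkov : ∀ (s : S) (B : Set (ℕ → S)), MeasurableSet B →
      P s ((fun (w : ℕ → S) (n : ℕ) => w (n + 1)) ⁻¹' B) = ∫⁻ t, P t B ∂(T s (ρ s)))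
    (A B : Set S) (hA : MeasurableSet A) (hB : MeasurableSet B)
    (hAB : Disjoint A B)
    (ε : ℝ≥0∞) (hε : 0 < ε)
    (hstep : ∀ s ∈ A, ε ≤ T s (ρ s) B) :
    ∀ s0 : S, P s0 {w | {k | w k ∈ A}.Infinite ∧ ∀ k : ℕ, w k ∉ B} = 0 := by
  have hE' : {w : ℕ → S | {k | w k ∈ A}.Infinite ∧ ∀ k : ℕ, w k ∉ B}
      = (⋂ n : ℕ, ⋃ k : ℕ, ⋃ _ : n < k, (fun w : ℕ → S => w k) ⁻¹' A) ∩
        ⋂ k : ℕ, (fun w : ℕ → S => w k) ⁻¹' Bᶜ := by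
    ext w
    simp only [Set.mem_setOf_eq, Set.mem_inter_iff, Set.mem_iInter, Set.mem_iUnion,
      Set.mem_preimage, Set.mem_compl_iff, exists_prop]
    refine and_congr_left fun _ => ⟨fun h n => ?_, fun h => ?_⟩
    · obtain ⟨k, hk, hn⟩ := h.exists_gt n
      exact ⟨k, hn, hk⟩
    · refine Set.infinite_of_forall_exists_gt fun n => ?_
      obtain ⟨k, hn, hk⟩ := h n
      exact ⟨k, hk, hn⟩
  set E : Set (ℕ → S) := {w | {k | w k ∈ A}.Infinite ∧ ∀ k : ℕ, w k ∉ B} with hEdef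
  have hE : MeasurableSet E := by
    rw [hE']
    refine MeasurableSet.inter (MeasurableSet.iInter fun n => MeasurableSet.iUnion fun k =>
      MeasurableSet.iUnion fun _ => measurable_pi_apply k hA)
      (MeasurableSet.iInter fun k => measurable_pi_apply k hB.compl)
  have hnull : ∀ s, ∀ᵐ w ∂(P s), w 0 = s := by
    intro s
    have := hPprob s
    have hm : MeasurableSet {w : ℕ → S | w 0 = s} :=
      measurable_pi_apply (X := fun _ : ℕ => S) 0 (measurableSet_singleton s)
    exact (mem_ae_iff_prob_eq_one hm).2 (hP0 s)
  -- shift invariance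
  have hshift : ∀ w ∈ E, (fun n => w (n + 1)) ∈ E := by
    rintro w ⟨h1, h2⟩
    refine ⟨Set.infinite_of_forall_exists_gt fun n => ?_, fun k => h2 _⟩
    obtain ⟨k, hk, hn⟩ := h1.exists_gt (n + 1)
    refine ⟨k - 1, ?_, by omega⟩
    have : k - 1 + 1 = k := by omega
    simpa [this] using hk
  have hstep1 : ∀ s, P s E ≤ ∫⁻ t, P t E ∂(T s (ρ s)) := by
    intro s
    rw [← hPMarkov s E hE]
    exact measure_mono hshift
  have hBzero : ∀ s ∈ B, P s E = 0 := by
    intro s hs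
    refine measure_mono_null (t := {w | ¬ w 0 = s}) ?_ (ae_iff.1 (hnull s))
    rintro w ⟨_, h2⟩ h0
    exact h2 0 (h0 ▸ hs)
  set c : ℝ≥0∞ := ⨆ s ∈ A, P s E with hc
  have hcA : ∀ s ∈ A, P s E ≤ c := fun s hs => le_iSup₂ (f := fun s _ => P s E) s hs
  have hc1 : c ≤ 1 := iSup₂_le fun s _ => by
    have := hPprob s
    exact prob_le_one
  -- first hitting decomposition
  let F : ℕ → Set (ℕ → S) := fun n => E ∩ ⋃ k : ℕ, ⋃ _ : k < n, (fun w : ℕ → S => w k) ⁻¹' A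
  have hF : ∀ n, MeasurableSet (F n) := fun n =>
    hE.inter (MeasurableSet.iUnion fun k => MeasurableSet.iUnion fun _ => measurable_pi_apply k hA)
  have hFc : ∀ n s, P s (F n) ≤ c := by
    intro n
    induction n with
    | zero => intro s; simp [F]
    | succ n ih =>
      intro s
      by_cases hs : s ∈ A
      · exact (measure_mono Set.inter_subset_left).trans (hcA s hs)
      · calc P s (F (n + 1)) ≤ P s ((fun (w : ℕ → S) (n : ℕ) => w (n + 1)) ⁻¹' (F n)) := by
              refine measure_mono_ae ?_
              filter_upwards [hnull s] with w hw hwF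
              obtain ⟨h1, h2⟩ := hwF
              refine ⟨hshift w h1, ?_⟩
              simp only [Set.mem_iUnion, Set.mem_preimage, exists_prop] at h2 ⊢
              obtain ⟨k, hk, hkA⟩ := h2
              cases k with
              | zero => exact absurd (hw ▸ hkA) hs
              | succ k => exact ⟨k, by omega, hkA⟩
          _ = ∫⁻ t, P t (F n) ∂(T s (ρ s)) := hPMarkov s _ (hF n)
          _ ≤ ∫⁻ _, c ∂(T s (ρ s)) := lintegral_mono fun t => ih t
          _ = c := by
              have := hT s (ρ s)
              simp
  have hall : ∀ s, P s E ≤ c := by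
    intro s
    have hU : E = ⋃ n, F n := by
      ext w
      simp only [F, Set.mem_iUnion, Set.mem_inter_iff, Set.mem_preimage, exists_prop]
      refine ⟨fun h => ?_, fun ⟨_, h, _⟩ => h⟩
      obtain ⟨k, hk⟩ := h.1.nonempty
      exact ⟨k + 1, h, k, by omega, hk⟩
    have hmono : Monotone F := by
      intro m n hmn w hw
      simp only [F, Set.mem_iUnion, Set.mem_inter_iff, Set.mem_preimage, exists_prop] at hw ⊢
      obtain ⟨h, k, hk, hkA⟩ := hw
      exact ⟨h, k, by omega, hkA⟩
    rw [hU, hmono.measure_iUnion]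
    exact iSup_le fun n => hFc n s
  have hcontr : c ≤ c * (1 - ε) := by
    refine iSup₂_le fun s hs => ?_
    have := hT s (ρ s)
    calc P s E ≤ ∫⁻ t, P t E ∂(T s (ρ s)) := hstep1 s
      _ ≤ ∫⁻ t, Bᶜ.indicator (fun _ => c) t ∂(T s (ρ s)) := by
          refine lintegral_mono fun t => ?_
          by_cases ht : t ∈ B
          · simp [hBzero t ht]
          · simpa [ht] using hall t
      _ = c * (1 - T s (ρ s) B) := by
          rw [lintegral_indicator_const hB.compl, prob_compl_eq_one_sub hB]
      _ ≤ c * (1 - ε) := by gcongr; exact hstep s hs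
  have hc0 : c = 0 := by
    by_contra h0
    have hlt : (1 : ℝ≥0∞) - ε < 1 := ENNReal.sub_lt_self ENNReal.one_ne_top one_ne_zero hε.ne'
    have hct : c ≠ ⊤ := ne_top_of_le_ne_top ENNReal.one_ne_top hc1
    have := (ENNReal.mul_lt_mul_iff_right h0 hct).2 hlt
    rw [mul_one] at this
    exact absurd hcontr (not_le.2 this)
  intro s0
  exact le_antisymm (hc0 ▸ hall s0) zero_le
end
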